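/- Let J ≥ 1 and S ≥ 2, let θ_s > 0 for each sector s ∈ {1,…,S} and set Θ = Σ_{s=1}^S θ_s, let a_{js} > 0 and L_i > 0, and for each s let K^s ∈ ℝ^{J×J} be entrywise nonnegative and irreducible. Define F : ℝ^{(2S+1)J}_{++} → ℝ^{(2S+1)J}_{++} on triples (Ω, P, W) with Ω = (Ω_{is}), P = (P_{is}) ∈ ℝ^{JS}_{++} and W = (W_i) ∈ ℝ^J_{++} by F^Ω_{is}(Ω,P,W) = Σ_{j=1}^J K^s_{ij} a_{js} P_{js}^{−1} W_j^{1/(1+Θ)}, F^P_{is}(Ω,P,W) = Σ_{j=1}^J K^s_{ji} W_j^{−θ_s/(1+Θ)}, and F^W_i(Ω,P,W) = Σ_{r=1}^S L_i^{−1} Ω_{ir} W_i^{(Θ−θ_r)/(1+Θ)}. Suppose (Ω*, P*, W*) ∈ ℝ^{(2S+1)J}_{++} is a fixed point of F. Then: (a) the fixed points of F are exactly the triples with components (c^{(1+θ_s)/(1+Θ)} Ω*_{is}, c^{−θ_s/(1+Θ)} P*_{is}, c W*_i) for c ∈ (0, ∞); (b) every fixed point of F is Lyapunov stable; and (c) for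 every starting point in ℝ^{(2S+1)J}_{++} the iterates of F converge to a fixed point of F. -/

import Mathlib

open Filter

/-- A matrix is irreducible if the directed graph on `Fin J` with an edge from `k` to `j`
whenever `M j k ≠ 0` is strongly connected. -/
def MatIrred {J : ℕ} (M : Matrix (Fin J) (Fin J) ℝ) : Prop :=
  ∀ a b : Fin J, Relation.TransGen (fun k j => M j k ≠ 0) a b

open Topology

/-- States `(Ω, P, W)` of the trade model. -/
abbrev TradeState (J S : ℕ) : Type :=
  (Fin J → Fin S → ℝ) × (Fin J → Fin S → ℝ) × (Fin J → ℝ)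

namespace TradeState

variable {J S : ℕ} {p q r : TradeState J S}

/-- All components are strictly positive. -/
def Pos (p : TradeState J S) : Prop :=
  (∀ i s, 0 < p.1 i s) ∧ (∀ i s, 0 < p.2.1 i s) ∧ (∀ i, 0 < p.2.2 i)

/-- The componentwise order, reversed in the `P` component. -/
def WLe (p q : TradeState J S) : Prop :=
  (∀ i s, p.1 i s ≤ q.1 i s) ∧ (∀ i s, q.2.1 i s ≤ p.2.1 i s) ∧ (∀ i, p.2.2 i ≤ q.2.2 i)

/-- Strict inequality in every component, reversed in the `P` component. -/
def SLt (p q : TradeState J S) : Prop :=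
  (∀ i s, p.1 i s < q.1 i s) ∧ (∀ i s, q.2.1 i s < p.2.1 i s) ∧ (∀ i, p.2.2 i < q.2.2 i)

theorem SLt.wLe (h : SLt p q) : WLe p q :=
  ⟨fun i s => (h.1 i s).le, fun i s => (h.2.1 i s).le, fun i => (h.2.2 i).le⟩

theorem WLe.trans (h : WLe p q) (h' : WLe q r) : WLe p r :=
  ⟨fun i s => (h.1 i s).trans (h'.1 i s), fun i s => (h'.2.1 i s).trans (h.2.1 i s),
    fun i => (h.2.2 i).trans (h'.2.2 i)⟩

theorem WLe.exists_lt_of_ne (h : WLe p q) (hne : p ≠ q) :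
    (∃ i s, p.1 i s < q.1 i s) ∨ (∃ i s, q.2.1 i s < p.2.1 i s) ∨ ∃ i, p.2.2 i < q.2.2 i := by
  contrapose! hne
  refine Prod.ext ?_ (Prod.ext ?_ ?_)
  · exact funext₂ fun i s => (h.1 i s).antisymm (hne.1 i s)
  · exact funext₂ fun i s => (hne.2.1 i s).antisymm (h.2.1 i s)
  · exact funext fun i => (h.2.2 i).antisymm (hne.2.2 i)

section Limits

variable {α : Type*} {l : Filter α} {f g : α → TradeState J S}

theorem tendsto_iff : Tendsto f l (𝓝 p) ↔
    (∀ i s, Tendsto (fun x => (f x).1 i s) l (𝓝 (p.1 i s))) ∧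
    (∀ i s, Tendsto (fun x => (f x).2.1 i s) l (𝓝 (p.2.1 i s))) ∧
    (∀ i, Tendsto (fun x => (f x).2.2 i) l (𝓝 (p.2.2 i))) := by
  simp only [Prod.tendsto_iff, tendsto_pi_nhds]

theorem wLe_of_tendsto [l.NeBot] (hf : Tendsto f l (𝓝 p)) (hg : Tendsto g l (𝓝 q))
    (h : ∀ᶠ x in l, WLe (f x) (g x)) : WLe p q := by
  rw [tendsto_iff] at hf hg
  exact ⟨fun i s => le_of_tendsto_of_tendsto (hf.1 i s) (hg.1 i s) (h.mono fun x hx => hx.1 i s),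
    fun i s => le_of_tendsto_of_tendsto (hg.2.1 i s) (hf.2.1 i s) (h.mono fun x hx => hx.2.1 i s),
    fun i => le_of_tendsto_of_tendsto (hf.2.2 i) (hg.2.2 i) (h.mono fun x hx => hx.2.2 i)⟩

theorem eventually_sLt (hf : Tendsto f l (𝓝 p)) (hg : Tendsto g l (𝓝 q)) (h : SLt p q) :
    ∀ᶠ x in l, SLt (f x) (g x) := by
  rw [tendsto_iff] at hf hg
  simp only [SLt, eventually_and, eventually_all]
  exact ⟨fun i s => (hf.1 i s).eventually_lt (hg.1 i s) (h.1 i s),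
    fun i s => (hg.2.1 i s).eventually_lt (hf.2.1 i s) (h.2.1 i s),
    fun i => (hf.2.2 i).eventually_lt (hg.2.2 i) (h.2.2 i)⟩

end Limits

theorem isCompact_wLe (p q : TradeState J S) : IsCompact {x | WLe p x ∧ WLe x q} := by
  convert isCompact_Icc (a := ((p.1, q.2.1, p.2.2) : TradeState J S)) (b := (q.1, p.2.1, q.2.2))
    using 1
  ext x
  simp only [WLe, Set.mem_ofPred_eq, Set.mem_Icc, Prod.le_def, Pi.le_def]
  tauto

theorem dist_lt_of_wLe {ε : ℝ} (hε : 0 < ε) {x y : TradeState J S} (hp : dist p x < ε)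
    (hr : dist r x < ε) (h : WLe p y) (h' : WLe y r) : dist y x < ε := by
  simp only [Prod.dist_eq, max_lt_iff, dist_pi_lt_iff hε, Real.dist_eq, abs_lt] at hp hr ⊢
  refine ⟨fun i s => ?_, fun i s => ?_, fun i => ?_⟩
  · have := hp.1 i s; have := hr.1 i s; have := h.1 i s; have := h'.1 i s
    constructor <;> linarith
  · have := hp.2.1 i s; have := hr.2.1 i s; have := h.2.1 i s; have := h'.2.1 i s
    constructor <;> linarith
  · have := hp.2.2 i; have := hr.2.2 i; have := h.2.2 i; have := h'.2.2 i
    constructor <;> linarith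

end TradeState

/-- Parameters of the multi-sector trade model. -/
structure TradeModel (J S : ℕ) where
  /-- sectoral trade elasticities -/
  θ : Fin S → ℝ
  /-- sum of the trade elasticities -/
  Θ : ℝ
  /-- expenditure constants -/
  a : Fin J → Fin S → ℝ
  /-- labor endowments -/
  L : Fin J → ℝ
  /-- sectoral kernels -/
  K : Fin S → Matrix (Fin J) (Fin J) ℝ
  one_le_J : 1 ≤ J
  two_le_S : 2 ≤ S
  θ_pos : ∀ s, 0 < θ s
  Θ_eq : Θ = ∑ s, θ s
  a_pos : ∀ j s, 0 < a j s
  L_pos : ∀ i, 0 < L i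
  K_nonneg : ∀ s i j, 0 ≤ K s i j
  K_irred : ∀ s, MatIrred (K s)

namespace TradeModel

open TradeState

variable {J S : ℕ} (T : TradeModel J S) {p q : TradeState J S} {c d : ℝ}

theorem θ_lt_Θ (r : Fin S) : T.θ r < T.Θ := by
  have : Nontrivial (Fin S) := Fin.nontrivial_iff_two_le.2 T.two_le_S
  obtain ⟨s, hs⟩ := exists_ne r
  rw [T.Θ_eq]
  exact Finset.single_lt_sum hs (Finset.mem_univ _) (Finset.mem_univ _) (T.θ_pos s)
    fun k _ _ => (T.θ_pos k).le

theorem one_add_Θ_pos : 0 < 1 + T.Θ := by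
  have := Finset.sum_nonneg fun s (_ : s ∈ Finset.univ) => (T.θ_pos s).le
  rw [T.Θ_eq]
  linarith

theorem exists_K_row_pos (s : Fin S) (i : Fin J) : ∃ j, 0 < T.K s i j := by
  obtain ⟨j, -, h⟩ := Relation.TransGen.tail'_iff.1 (T.K_irred s i i)
  exact ⟨j, (T.K_nonneg s i j).lt_of_ne' h⟩

theorem exists_K_col_pos (s : Fin S) (i : Fin J) : ∃ j, 0 < T.K s j i := by
  obtain ⟨j, h, -⟩ := Relation.TransGen.head'_iff.1 (T.K_irred s i i)
  exact ⟨j, (T.K_nonneg s j i).lt_of_ne' h⟩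

/-- The equilibrium map. -/
noncomputable def map (p : TradeState J S) : TradeState J S :=
  (fun i s => ∑ j, T.K s i j * T.a j s * (p.2.1 j s)⁻¹ * p.2.2 j ^ ((1 : ℝ) / (1 + T.Θ)),
   fun i s => ∑ j, T.K s j i * p.2.2 j ^ (-(T.θ s) / (1 + T.Θ)),
   fun i => ∑ r, (T.L i)⁻¹ * p.1 i r * p.2.2 i ^ ((T.Θ - T.θ r) / (1 + T.Θ)))

/-- The one-parameter family of rescalings of a state. -/
noncomputable def ray (p : TradeState J S) (c : ℝ) : TradeState J S :=
  (fun i s => c ^ ((1 + T.θ s) / (1 + T.Θ)) * p.1 i s,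
   fun i s => c ^ (-(T.θ s) / (1 + T.Θ)) * p.2.1 i s,
   fun i => c * p.2.2 i)

theorem exp_Ω_pos (s : Fin S) : 0 < (1 + T.θ s) / (1 + T.Θ) :=
  div_pos (by linarith [T.θ_pos s]) T.one_add_Θ_pos

theorem exp_P_neg (s : Fin S) : -(T.θ s) / (1 + T.Θ) < 0 :=
  div_neg_of_neg_of_pos (neg_lt_zero.2 (T.θ_pos s)) T.one_add_Θ_pos

theorem exp_W_pos (s : Fin S) : 0 < (T.Θ - T.θ s) / (1 + T.Θ) :=
  div_pos (sub_pos.2 (T.θ_lt_Θ s)) T.one_add_Θ_pos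

theorem one_div_pos : 0 < (1 : ℝ) / (1 + T.Θ) := _root_.one_div_pos.2 T.one_add_Θ_pos

theorem pos_map (hp : Pos p) : Pos (T.map p) := by
  refine ⟨fun i s => ?_, fun i s => ?_, fun i => ?_⟩
  · obtain ⟨j, hj⟩ := T.exists_K_row_pos s i
    refine Finset.sum_pos' (fun k _ => ?_) ⟨j, Finset.mem_univ _, ?_⟩
    · have := T.K_nonneg s i k; have := T.a_pos k s; have := hp.2.1 k s; have := hp.2.2 k
      positivity
    · have := T.a_pos j s; have := hp.2.1 j s; have := hp.2.2 j
      positivity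
  · obtain ⟨j, hj⟩ := T.exists_K_col_pos s i
    refine Finset.sum_pos' (fun k _ => ?_) ⟨j, Finset.mem_univ _, ?_⟩
    · have := T.K_nonneg s k i; have := hp.2.2 k
      positivity
    · have := hp.2.2 j
      positivity
  · refine Finset.sum_pos (fun r _ => ?_)
      ⟨(⟨0, by have := T.two_le_S; lia⟩ : Fin S), Finset.mem_univ _⟩
    have := T.L_pos i; have := hp.1 i r; have := hp.2.2 i
    positivity

theorem pos_iterate (hp : Pos p) (n : ℕ) : Pos (T.map^[n] p) := by
  induction n with
  | zero => exact hp
  | succ n ih => rw [Function.iterate_succ_apply']; exact T.pos_map ih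

theorem pos_ray (hp : Pos p) (hc : 0 < c) : Pos (T.ray p c) :=
  ⟨fun i s => mul_pos (Real.rpow_pos_of_pos hc _) (hp.1 i s),
    fun i s => mul_pos (Real.rpow_pos_of_pos hc _) (hp.2.1 i s),
    fun i => mul_pos hc (hp.2.2 i)⟩

section Monotone

variable (hp : Pos p) (h : WLe p q)
include hp h

theorem map_Ω_term_le (i j : Fin J) (s : Fin S) (hP : 0 < q.2.1 j s) :
    T.K s i j * T.a j s * (p.2.1 j s)⁻¹ * p.2.2 j ^ ((1 : ℝ) / (1 + T.Θ)) ≤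
      T.K s i j * T.a j s * (q.2.1 j s)⁻¹ * q.2.2 j ^ ((1 : ℝ) / (1 + T.Θ)) := by
  have := T.K_nonneg s i j; have := T.a_pos j s; have := hp.2.2 j
  have := T.one_div_pos; have := h.2.1 j s; have := h.2.2 j
  gcongr

theorem map_P_term_le (i j : Fin J) (s : Fin S) :
    T.K s j i * q.2.2 j ^ (-(T.θ s) / (1 + T.Θ)) ≤
      T.K s j i * p.2.2 j ^ (-(T.θ s) / (1 + T.Θ)) :=
  mul_le_mul_of_nonneg_left
    (Real.rpow_le_rpow_of_nonpos (hp.2.2 j) (h.2.2 j) (T.exp_P_neg s).le) (T.K_nonneg s j i)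

theorem map_W_term_le (i : Fin J) (r : Fin S) :
    (T.L i)⁻¹ * p.1 i r * p.2.2 i ^ ((T.Θ - T.θ r) / (1 + T.Θ)) ≤
      (T.L i)⁻¹ * q.1 i r * q.2.2 i ^ ((T.Θ - T.θ r) / (1 + T.Θ)) := by
  have := T.L_pos i; have := hp.1 i r; have := hp.2.2 i
  have := h.1 i r; have := h.2.2 i; have := T.exp_W_pos r; have : 0 < q.1 i r := by linarith
  gcongr

theorem map_mono (hq : Pos q) : WLe (T.map p) (T.map q) :=
  ⟨fun i s => Finset.sum_le_sum (s := .univ) fun j _ => T.map_Ω_term_le hp h i j s (hq.2.1 j s),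
    fun i s => Finset.sum_le_sum (s := .univ) fun j _ => T.map_P_term_le hp h i j s,
    fun i => Finset.sum_le_sum (s := .univ) fun r _ => T.map_W_term_le hp h i r⟩

theorem map_Ω_lt (hq : Pos q) {i j : Fin J} {s : Fin S} (hK : 0 < T.K s i j)
    (hlt : q.2.1 j s < p.2.1 j s ∨ p.2.2 j < q.2.2 j) : (T.map p).1 i s < (T.map q).1 i s := by
  refine Finset.sum_lt_sum (fun j _ => T.map_Ω_term_le hp h i j s (hq.2.1 j s))
    ⟨j, Finset.mem_univ _, ?_⟩
  have := T.a_pos j s; have := hp.2.2 j; have := hq.2.2 j; have := hq.2.1 j s; have := hp.2.1 j s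
  have := T.one_div_pos; have := h.2.1 j s; have := h.2.2 j
  rcases hlt with hlt | hlt
  · calc _ < T.K s i j * T.a j s * (q.2.1 j s)⁻¹ * p.2.2 j ^ ((1 : ℝ) / (1 + T.Θ)) := by gcongr
      _ ≤ _ := by gcongr
  · calc _ < T.K s i j * T.a j s * (p.2.1 j s)⁻¹ * q.2.2 j ^ ((1 : ℝ) / (1 + T.Θ)) := by gcongr
      _ ≤ _ := by gcongr

theorem map_P_lt {i j : Fin J} {s : Fin S} (hK : 0 < T.K s j i) (hlt : p.2.2 j < q.2.2 j) :
    (T.map q).2.1 i s < (T.map p).2.1 i s :=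
  Finset.sum_lt_sum (fun j _ => T.map_P_term_le hp h i j s) ⟨j, Finset.mem_univ _,
    mul_lt_mul_of_pos_left (Real.rpow_lt_rpow_of_neg (hp.2.2 j) hlt (T.exp_P_neg s)) hK⟩

theorem map_W_lt (hq : Pos q) {i : Fin J} (r : Fin S)
    (hlt : p.1 i r < q.1 i r ∨ p.2.2 i < q.2.2 i) : (T.map p).2.2 i < (T.map q).2.2 i := by
  refine Finset.sum_lt_sum (fun r _ => T.map_W_term_le hp h i r) ⟨r, Finset.mem_univ _, ?_⟩
  have := T.L_pos i; have := hp.1 i r; have := hp.2.2 i; have := hq.1 i r; have := hq.2.2 i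
  have := h.1 i r; have := h.2.2 i; have := T.exp_W_pos r
  rcases hlt with hlt | hlt
  · calc _ < (T.L i)⁻¹ * q.1 i r * p.2.2 i ^ ((T.Θ - T.θ r) / (1 + T.Θ)) := by gcongr
      _ ≤ _ := by gcongr
  · calc _ < (T.L i)⁻¹ * p.1 i r * q.2.2 i ^ ((T.Θ - T.θ r) / (1 + T.Θ)) := by gcongr
      _ ≤ _ := by gcongr

end Monotone

theorem iterate_wLe (hp : Pos p) (hq : Pos q) (hfix : T.map q = q) (h : WLe p q) (n : ℕ) :
    WLe (T.map^[n] p) q := by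
  induction n with
  | zero => exact h
  | succ n ih =>
    rw [Function.iterate_succ_apply', ← hfix]
    exact T.map_mono (T.pos_iterate hp n) ih hq

theorem wLe_iterate (hp : Pos p) (hq : Pos q) (hfix : T.map q = q) (h : WLe q p) (n : ℕ) :
    WLe q (T.map^[n] p) := by
  induction n with
  | zero => exact h
  | succ n ih =>
    rw [Function.iterate_succ_apply', ← hfix]
    exact T.map_mono hq ih (T.pos_iterate hp n)

section Spread

variable (hp : Pos p) (hq : Pos q) (hfix : T.map q = q) (h : WLe p q)
include hp hq hfix h

theorem eventually_W_lt_of_lt {i : Fin J} {n : ℕ} (hn : (T.map^[n] p).2.2 i < q.2.2 i) :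
    ∀ᶠ m in atTop, (T.map^[m] p).2.2 i < q.2.2 i := by
  refine eventually_atTop.2 ⟨n, fun m hm => ?_⟩
  induction m, hm using Nat.le_induction with
  | base => exact hn
  | succ m _ ih =>
    rw [Function.iterate_succ_apply', ← hfix]
    exact T.map_W_lt (T.pos_iterate hp m) (T.iterate_wLe hp hq hfix h m) hq
      ⟨0, by have := T.two_le_S; lia⟩ (.inr ih)

theorem eventually_W_lt_of_Ω_lt {i : Fin J} {s : Fin S} {n : ℕ}
    (hn : (T.map^[n] p).1 i s < q.1 i s) :
    ∀ᶠ m in atTop, (T.map^[m] p).2.2 i < q.2.2 i := by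
  refine T.eventually_W_lt_of_lt hp hq hfix h (n := n + 1) ?_
  rw [Function.iterate_succ_apply', ← hfix]
  exact T.map_W_lt (T.pos_iterate hp n) (T.iterate_wLe hp hq hfix h n) hq s (.inl hn)

theorem iterate_Ω_lt {i j : Fin J} {s : Fin S} {n : ℕ} (hK : 0 < T.K s i j)
    (hn : q.2.1 j s < (T.map^[n] p).2.1 j s ∨ (T.map^[n] p).2.2 j < q.2.2 j) :
    (T.map^[n + 1] p).1 i s < q.1 i s := by
  rw [Function.iterate_succ_apply']
  conv_rhs => rw [← hfix]
  exact T.map_Ω_lt (T.pos_iterate hp n) (T.iterate_wLe hp hq hfix h n) hq hK hn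

theorem exists_eventually_W_lt (hne : p ≠ q) :
    ∃ i, ∀ᶠ m in atTop, (T.map^[m] p).2.2 i < q.2.2 i := by
  rcases h.exists_lt_of_ne hne with ⟨i, s, hlt⟩ | ⟨j, s, hlt⟩ | ⟨i, hlt⟩
  · exact ⟨i, T.eventually_W_lt_of_Ω_lt hp hq hfix h (n := 0) hlt⟩
  · obtain ⟨i, hK⟩ := T.exists_K_col_pos s j
    exact ⟨i, T.eventually_W_lt_of_Ω_lt hp hq hfix h
      (T.iterate_Ω_lt hp hq hfix h (n := 0) hK (.inl hlt))⟩
  · exact ⟨i, T.eventually_W_lt_of_lt hp hq hfix h (n := 0) hlt⟩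

theorem eventually_W_lt (hne : p ≠ q) (i : Fin J) :
    ∀ᶠ m in atTop, (T.map^[m] p).2.2 i < q.2.2 i := by
  obtain ⟨k, hk⟩ := T.exists_eventually_W_lt hp hq hfix h hne
  let s : Fin S := ⟨0, by have := T.two_le_S; lia⟩
  have step : ∀ j i, T.K s i j ≠ 0 → (∀ᶠ m in atTop, (T.map^[m] p).2.2 j < q.2.2 j) →
      ∀ᶠ m in atTop, (T.map^[m] p).2.2 i < q.2.2 i := fun j i hK hj => by
    obtain ⟨n, hn⟩ := hj.exists
    exact T.eventually_W_lt_of_Ω_lt hp hq hfix h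
      (T.iterate_Ω_lt hp hq hfix h ((T.K_nonneg s i j).lt_of_ne' hK) (.inr hn))
  induction T.K_irred s k i with
  | single hK => exact step _ _ hK hk
  | tail _ hK ih => exact step _ _ hK ih

theorem exists_iterate_sLt (hne : p ≠ q) : ∃ n, SLt (T.map^[n] p) q := by
  have hW := eventually_all.2 (T.eventually_W_lt hp hq hfix h hne)
  obtain ⟨n, hn, hn'⟩ := (hW.and ((tendsto_add_atTop_nat 1).eventually hW)).exists
  refine ⟨n + 1, fun i s => ?_, fun i s => ?_, hn'⟩
  · obtain ⟨j, hK⟩ := T.exists_K_row_pos s i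
    exact T.iterate_Ω_lt hp hq hfix h hK (.inr (hn j))
  · obtain ⟨j, hK⟩ := T.exists_K_col_pos s i
    rw [Function.iterate_succ_apply']
    conv_lhs => rw [← hfix]
    exact T.map_P_lt (T.pos_iterate hp n) (T.iterate_wLe hp hq hfix h n) hK (hn j)

end Spread

theorem map_ray (hp : Pos p) (hfix : T.map p = p) (hc : 0 < c) :
    T.map (T.ray p c) = T.ray p c := by
  have hΘ := T.one_add_Θ_pos.ne'
  have hrpow (e : ℝ) (i : Fin J) : (c * p.2.2 i) ^ e = c ^ e * p.2.2 i ^ e :=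
    Real.mul_rpow hc.le (hp.2.2 i).le
  refine Prod.ext (funext₂ fun i s => ?_) (Prod.ext (funext₂ fun i s => ?_) (funext fun i => ?_))
  · have he : c ^ ((1 + T.θ s) / (1 + T.Θ)) =
        (c ^ (-(T.θ s) / (1 + T.Θ)))⁻¹ * c ^ ((1 : ℝ) / (1 + T.Θ)) := by
      rw [← Real.rpow_neg hc.le, ← Real.rpow_add hc]
      congr 1
      ring
    have := congrArg (c ^ ((1 + T.θ s) / (1 + T.Θ)) * ·) (congrFun₂ (congrArg Prod.fst hfix) i s)
    refine Eq.trans ?_ this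
    simp only [map, ray, Finset.mul_sum, hrpow, mul_inv, he]
    exact Finset.sum_congr rfl fun j _ => by ring
  · have := congrArg (c ^ (-(T.θ s) / (1 + T.Θ)) * ·)
      (congrFun₂ (congrArg (fun x => x.2.1) hfix) i s)
    refine Eq.trans ?_ this
    simp only [map, ray, Finset.mul_sum, hrpow]
    exact Finset.sum_congr rfl fun j _ => by ring
  · have := congrArg (c * ·) (congrFun (congrArg (fun x => x.2.2) hfix) i)
    refine Eq.trans ?_ this
    simp only [map, ray, Finset.mul_sum, hrpow]
    refine Finset.sum_congr rfl fun r _ => ?_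
    have he : c = c ^ ((1 + T.θ r) / (1 + T.Θ)) * c ^ ((T.Θ - T.θ r) / (1 + T.Θ)) := by
      rw [← Real.rpow_add hc, ← add_div, show 1 + T.θ r + (T.Θ - T.θ r) = 1 + T.Θ by ring,
        div_self hΘ, Real.rpow_one]
    conv_rhs => rw [he]
    ring

theorem ray_sLt (hp : Pos p) (hc : 0 < c) (hcd : c < d) : SLt (T.ray p c) (T.ray p d) :=
  ⟨fun i s => mul_lt_mul_of_pos_right (Real.rpow_lt_rpow hc.le hcd (T.exp_Ω_pos s)) (hp.1 i s),
    fun i s => mul_lt_mul_of_pos_right (Real.rpow_lt_rpow_of_neg hc hcd (T.exp_P_neg s))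
      (hp.2.1 i s),
    fun i => mul_lt_mul_of_pos_right hcd (hp.2.2 i)⟩

theorem tendsto_ray (hc : 0 < c) : Tendsto (T.ray p) (𝓝 c) (𝓝 (T.ray p c)) :=
  tendsto_iff.2 ⟨fun _ _ => ((Real.continuousAt_rpow_const _ _ (.inl hc.ne')).tendsto).mul_const _,
    fun _ _ => ((Real.continuousAt_rpow_const _ _ (.inl hc.ne')).tendsto).mul_const _,
    fun _ => tendsto_id.mul_const _⟩

theorem tendsto_map {α : Type*} {l : Filter α} {f : α → TradeState J S} (hp : Pos p)
    (hf : Tendsto f l (𝓝 p)) : Tendsto (fun x => T.map (f x)) l (𝓝 (T.map p)) := by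
  rw [tendsto_iff] at hf
  refine tendsto_iff.2 ⟨fun i s => ?_, fun i s => ?_, fun i => ?_⟩
  · exact tendsto_finsetSum .univ fun j _ =>
      (((hf.2.1 j s).inv₀ (hp.2.1 j s).ne').const_mul (T.K s i j * T.a j s)).mul
        ((hf.2.2 j).rpow_const (.inl (hp.2.2 j).ne'))
  · exact tendsto_finsetSum .univ fun j _ =>
      ((hf.2.2 j).rpow_const (.inl (hp.2.2 j).ne')).const_mul (T.K s j i)
  · exact tendsto_finsetSum .univ fun r _ => ((hf.1 i r).const_mul (T.L i)⁻¹).mul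
      ((hf.2.2 i).rpow_const (.inl (hp.2.2 i).ne'))

theorem tendsto_iterate {α : Type*} {l : Filter α} {f : α → TradeState J S} (hp : Pos p)
    (hf : Tendsto f l (𝓝 p)) (n : ℕ) :
    Tendsto (fun x => T.map^[n] (f x)) l (𝓝 (T.map^[n] p)) := by
  induction n with
  | zero => exact hf
  | succ n ih =>
    simp only [Function.iterate_succ_apply']
    exact T.tendsto_map (T.pos_iterate hp n) ih

theorem exists_wLe_ray (hp : Pos p) (hq : Pos q) : ∃ c, 0 < c ∧ WLe q (T.ray p c) := by
  have key : ∀ᶠ c in atTop, WLe q (T.ray p c) := by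
    simp only [WLe, eventually_and, eventually_all]
    refine ⟨fun i s => ?_, fun i s => ?_, fun i => ?_⟩
    · exact ((tendsto_rpow_atTop (T.exp_Ω_pos s)).atTop_mul_const (hp.1 i s)).eventually_ge_atTop _
    · have := (tendsto_rpow_neg_atTop (neg_pos.2 (T.exp_P_neg s))).mul_const (p.2.1 i s)
      rw [neg_neg, zero_mul] at this
      exact this.eventually_le_const (hq.2.1 i s)
    · exact (tendsto_id.atTop_mul_const (hp.2.2 i)).eventually_ge_atTop _
  exact ((eventually_gt_atTop 0).and key).exists

theorem exists_ray_wLe (hp : Pos p) (hq : Pos q) : ∃ c, 0 < c ∧ WLe (T.ray p c) q := by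
  obtain ⟨c, hc, h⟩ := T.exists_wLe_ray hq hp
  have hmul (e x : ℝ) : c⁻¹ ^ e * (c ^ e * x) = x := by
    rw [← mul_assoc, ← Real.mul_rpow (inv_nonneg.2 hc.le) hc.le, inv_mul_cancel₀ hc.ne',
      Real.one_rpow, one_mul]
  have hc' := inv_pos.2 hc
  refine ⟨c⁻¹, hc', fun i s => ?_, fun i s => ?_, fun i => ?_⟩
  · exact (mul_le_mul_of_nonneg_left (h.1 i s) (Real.rpow_nonneg hc'.le _)).trans_eq (hmul _ _)
  · exact (hmul _ _).symm.trans_le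
      (mul_le_mul_of_nonneg_left (h.2.1 i s) (Real.rpow_nonneg hc'.le _))
  · exact (mul_le_mul_of_nonneg_left (h.2.2 i) hc'.le).trans_eq
      (inv_mul_cancel_left₀ hc.ne' _)

section Fixed

variable (hp : Pos p) (hfix : T.map p = p)
include hp hfix

theorem ray_stable (hc : 0 < c) {ε : ℝ} (hε : 0 < ε) :
    ∃ δ > 0, ∀ x, Pos x → dist x (T.ray p c) < δ →
      ∀ n, dist (T.map^[n] x) (T.ray p c) < ε := by
  have hball : ∀ᶠ d in 𝓝 c, 0 < d ∧ dist (T.ray p d) (T.ray p c) < ε :=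
    (lt_mem_nhds hc).and (Metric.tendsto_nhds.1 (T.tendsto_ray hc) ε hε)
  obtain ⟨u, ⟨hu, hu'⟩, huc⟩ :=
    ((hball.filter_mono nhdsWithin_le_nhds).and (self_mem_nhdsWithin (s := Set.Iio c))).exists
  obtain ⟨v, ⟨hv, hv'⟩, hcv⟩ :=
    ((hball.filter_mono nhdsWithin_le_nhds).and (self_mem_nhdsWithin (s := Set.Ioi c))).exists
  obtain ⟨δ, hδ, hx⟩ := Metric.eventually_nhds_iff.1 <|
    (eventually_sLt tendsto_const_nhds tendsto_id (T.ray_sLt hp hu huc)).and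
    (eventually_sLt tendsto_id tendsto_const_nhds (T.ray_sLt hp hc hcv))
  refine ⟨δ, hδ, fun x hxpos hxδ n => ?_⟩
  exact dist_lt_of_wLe hε hu' hv'
    (T.wLe_iterate hxpos (T.pos_ray hp hu) (T.map_ray hp hfix hu) (hx hxδ).1.wLe n)
    (T.iterate_wLe hxpos (T.pos_ray hp hv) (T.map_ray hp hfix hv) (hx hxδ).2.wLe n)

theorem exists_tendsto_ray (hq : Pos q) :
    ∃ c, 0 < c ∧ Tendsto (fun n => T.map^[n] q) atTop (𝓝 (T.ray p c)) := by
  obtain ⟨u, hu, huq⟩ := T.exists_ray_wLe hp hq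
  obtain ⟨v, hv, hqv⟩ := T.exists_wLe_ray hp hq
  have hlow := T.wLe_iterate hq (T.pos_ray hp hu) (T.map_ray hp hfix hu) huq
  have hupp := T.iterate_wLe hq (T.pos_ray hp hv) (T.map_ray hp hfix hv) hqv
  obtain ⟨x, ⟨hux, hxv⟩, φ, hφ, hx⟩ := (isCompact_wLe (T.ray p u) (T.ray p v)).tendsto_subseq
    (x := fun n => T.map^[n] q) fun n => ⟨hlow n, hupp n⟩
  have hxpos : Pos x :=
    ⟨fun i s => ((T.pos_ray hp hu).1 i s).trans_le (hux.1 i s),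
      fun i s => ((T.pos_ray hp hv).2.1 i s).trans_le (hxv.2.1 i s),
      fun i => ((T.pos_ray hp hu).2.2 i).trans_le (hux.2.2 i)⟩
  let C : Set ℝ := {c | 0 < c ∧ ∃ n, WLe (T.map^[n] q) (T.ray p c)}
  have hCu : u ∈ lowerBounds C := fun c ⟨_, n, hn⟩ =>
    le_of_mul_le_mul_right (((hlow n).trans hn).2.2 (⟨0, T.one_le_J⟩ : Fin J)) (hp.2.2 _)
  have hC0 : 0 < sInf C := hu.trans_le (le_csInf ⟨v, hv, 0, hqv⟩ hCu)
  have hxle : WLe x (T.ray p (sInf C)) := by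
    refine wLe_of_tendsto (l := 𝓝[>] sInf C) tendsto_const_nhds
      ((T.tendsto_ray hC0).mono_left nhdsWithin_le_nhds) ?_
    filter_upwards [self_mem_nhdsWithin] with c hc
    obtain ⟨d, ⟨hd, n, hn⟩, hdc⟩ := exists_lt_of_csInf_lt (s := C) ⟨v, hv, 0, hqv⟩ hc
    refine WLe.trans ?_ (T.ray_sLt hp hd hdc).wLe
    refine wLe_of_tendsto hx tendsto_const_nhds ?_
    filter_upwards [hφ.tendsto_atTop.eventually_ge_atTop n] with k hk
    have := T.iterate_wLe (T.pos_iterate hq n) (T.pos_ray hp hd) (T.map_ray hp hfix hd) hn (φ k - n)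
    rwa [← Function.iterate_add_apply, Nat.sub_add_cancel hk] at this
  have hxeq : x = T.ray p (sInf C) := by
    by_contra hne
    obtain ⟨n, hn⟩ := T.exists_iterate_sLt hxpos (T.pos_ray hp hC0) (T.map_ray hp hfix hC0) hxle hne
    obtain ⟨c, ⟨hc0, hc⟩, hcC⟩ := ((((lt_mem_nhds hC0).and
      (eventually_sLt tendsto_const_nhds (T.tendsto_ray hC0) hn)).filter_mono
        nhdsWithin_le_nhds).and (self_mem_nhdsWithin (s := Set.Iio (sInf C)))).exists
    obtain ⟨k, hk⟩ := (eventually_sLt (T.tendsto_iterate hxpos hx n) tendsto_const_nhds hc).exists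
    refine (csInf_le ⟨u, hCu⟩ (show c ∈ C from ⟨hc0, n + φ k, ?_⟩)).not_gt hcC
    rw [Function.iterate_add_apply]
    exact hk.wLe
  refine ⟨sInf C, hC0, Metric.tendsto_atTop.2 fun ε hε => ?_⟩
  obtain ⟨δ, hδ, hstab⟩ := T.ray_stable hp hfix hC0 hε
  obtain ⟨k, hk⟩ := (Metric.tendsto_nhds.1 (hxeq ▸ hx) δ hδ).exists
  refine ⟨φ k, fun n hn => ?_⟩
  have := hstab _ (T.pos_iterate hq _) hk (n - φ k)
  rwa [← Function.iterate_add_apply, Nat.sub_add_cancel hn] at this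

theorem exists_eq_ray (hq : Pos q) (hqfix : T.map q = q) : ∃ c, 0 < c ∧ q = T.ray p c := by
  obtain ⟨c, hc, h⟩ := T.exists_tendsto_ray hp hfix hq
  simp only [Function.iterate_fixed hqfix] at h
  exact ⟨c, hc, tendsto_nhds_unique tendsto_const_nhds h⟩

end Fixed

end TradeModel

/-- **Multi-sector trade model without intermediates.**
With sectoral trade elasticities `θ_s > 0`, `Θ = Σ_s θ_s`, constants `a_{js} > 0`, labor
endowments `L_i > 0`, and nonnegative irreducible sectoral kernels `K^s`, the map
`F^Ω_{is} = Σ_j K^s_{ij} a_{js} P_{js}⁻¹ W_j^{1/(1+Θ)}`,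
`F^P_{is} = Σ_j K^s_{ji} W_j^{−θ_s/(1+Θ)}`,
`F^W_i = Σ_r L_i⁻¹ Ω_{ir} W_i^{(Θ−θ_r)/(1+Θ)}`
has the following properties, given a fixed point `(Ω*,P*,W*)` in the positive orthant:
(a) the fixed points in the positive orthant are exactly
`(c^{(1+θ_s)/(1+Θ)} Ω*_{is}, c^{−θ_s/(1+Θ)} P*_{is}, c W*_i)`, `c > 0`; (b) every such
fixed point is Lyapunov stable; (c) from every starting point in the positive orthant
the iterates of `F` converge to a fixed point. -/
theorem multi_sector_trade_model
    {J S : ℕ} (hJ : 1 ≤ J) (hS : 2 ≤ S)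
    (θ : Fin S → ℝ) (hθ : ∀ s, 0 < θ s) (Θ : ℝ) (hΘ : Θ = ∑ s, θ s)
    (a : Fin J → Fin S → ℝ) (ha : ∀ j s, 0 < a j s)
    (L : Fin J → ℝ) (hL : ∀ i, 0 < L i)
    (K : Fin S → Matrix (Fin J) (Fin J) ℝ)
    (hK0 : ∀ s i j, 0 ≤ K s i j) (hKirr : ∀ s, MatIrred (K s))
    (F : (Fin J → Fin S → ℝ) × (Fin J → Fin S → ℝ) × (Fin J → ℝ) →
         (Fin J → Fin S → ℝ) × (Fin J → Fin S → ℝ) × (Fin J → ℝ))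
    (hF : ∀ p : (Fin J → Fin S → ℝ) × (Fin J → Fin S → ℝ) × (Fin J → ℝ), F p =
      (fun i s => ∑ j, K s i j * a j s * (p.2.1 j s)⁻¹ * p.2.2 j ^ ((1 : ℝ) / (1 + Θ)),
       fun i s => ∑ j, K s j i * p.2.2 j ^ (-(θ s) / (1 + Θ)),
       fun i => ∑ r, (L i)⁻¹ * p.1 i r * p.2.2 i ^ ((Θ - θ r) / (1 + Θ))))
    (pstar : (Fin J → Fin S → ℝ) × (Fin J → Fin S → ℝ) × (Fin J → ℝ))
    (hpos : (∀ i s, 0 < pstar.1 i s) ∧ (∀ i s, 0 < pstar.2.1 i s) ∧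
      (∀ i, 0 < pstar.2.2 i))
    (hfix : F pstar = pstar) :
    ({p : (Fin J → Fin S → ℝ) × (Fin J → Fin S → ℝ) × (Fin J → ℝ) |
        ((∀ i s, 0 < p.1 i s) ∧ (∀ i s, 0 < p.2.1 i s) ∧ (∀ i, 0 < p.2.2 i)) ∧
        F p = p} =
      {p : (Fin J → Fin S → ℝ) × (Fin J → Fin S → ℝ) × (Fin J → ℝ) | ∃ c : ℝ, 0 < c ∧
        p = (fun i s => c ^ ((1 + θ s) / (1 + Θ)) * pstar.1 i s,
             fun i s => c ^ (-(θ s) / (1 + Θ)) * pstar.2.1 i s,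
             fun i => c * pstar.2.2 i)}) ∧
    (∀ q : (Fin J → Fin S → ℝ) × (Fin J → Fin S → ℝ) × (Fin J → ℝ),
      ((∀ i s, 0 < q.1 i s) ∧ (∀ i s, 0 < q.2.1 i s) ∧ (∀ i, 0 < q.2.2 i)) →
      F q = q →
      ∀ ε > (0 : ℝ), ∃ δ > (0 : ℝ),
        ∀ p : (Fin J → Fin S → ℝ) × (Fin J → Fin S → ℝ) × (Fin J → ℝ),
        ((∀ i s, 0 < p.1 i s) ∧ (∀ i s, 0 < p.2.1 i s) ∧ (∀ i, 0 < p.2.2 i)) →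
        dist p q < δ → ∀ n : ℕ, dist (F^[n] p) (F^[n] q) < ε) ∧
    (∀ p : (Fin J → Fin S → ℝ) × (Fin J → Fin S → ℝ) × (Fin J → ℝ),
      ((∀ i s, 0 < p.1 i s) ∧ (∀ i s, 0 < p.2.1 i s) ∧ (∀ i, 0 < p.2.2 i)) →
      ∃ q : (Fin J → Fin S → ℝ) × (Fin J → Fin S → ℝ) × (Fin J → ℝ),
        ((∀ i s, 0 < q.1 i s) ∧ (∀ i s, 0 < q.2.1 i s) ∧ (∀ i, 0 < q.2.2 i)) ∧
        F q = q ∧ Tendsto (fun n => F^[n] p) atTop (nhds q)) := by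
  let T : TradeModel J S := ⟨θ, Θ, a, L, K, hJ, hS, hθ, hΘ, ha, hL, hK0, hKirr⟩
  obtain rfl : F = T.map := funext hF
  refine ⟨Set.ext fun p => ⟨fun ⟨hp, h⟩ => T.exists_eq_ray hpos hfix hp h, ?_⟩,
    fun q hq hqfix ε hε => ?_, fun p hp => ?_⟩
  · rintro ⟨c, hc, rfl⟩
    exact ⟨T.pos_ray hpos hc, T.map_ray hpos hfix hc⟩
  · obtain ⟨c, hc, rfl⟩ := T.exists_eq_ray hpos hfix hq hqfix
    simp only [Function.iterate_fixed hqfix]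
    exact T.ray_stable hpos hfix hc hε
  · obtain ⟨c, hc, h⟩ := T.exists_tendsto_ray hpos hfix hp
    exact ⟨_, T.pos_ray hpos hc, T.map_ray hpos hfix hc, h⟩
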